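/- The Approval Chamberlin–Courant rule is the only non-trivial ABC choice rule that satisfies symmetry, consistency, weak efficiency, continuity, and disjoint diversity: a non-trivial ABC choice rule R satisfies these five axioms if and only if for every approval profile A, R(A) is the set of committees W maximizing score_{f_CC}(W,A). -/

import Mathlib

namespace ABC

/-- An approval profile: a list of approval ballots (one per voter),
each ballot a subset of the candidate set `Fin m`. -/
abbrev Profile (m : ℕ) := List (Finset (Fin m))

/-- `n`-fold concatenation of a profile with itself. -/
def nCopies {m : ℕ} (n : ℕ) (A : Profile m) : Profile m := (List.replicate n A).flatten

/-- A counting function `f : {0,…,k} × {0,…,m} → ℝ`, weakly increasing in the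
first coordinate. -/
def IsCountingFunction (m k : ℕ) (f : ℕ → ℕ → ℝ) : Prop :=
  ∀ x x' y : ℕ, x' ≤ x → x ≤ k → y ≤ m → f x' y ≤ f x y

/-- The `f`-score of a committee `W` in a profile `A`. -/
noncomputable def score {m : ℕ} (f : ℕ → ℕ → ℝ) (W : Finset (Fin m)) (A : Profile m) : ℝ :=
  (A.map (fun s => f (s ∩ W).card s.card)).sum

/-- An ABC ranking rule: a weak order (complete, transitive) on committees
(size-`k` subsets of the `m` candidates) for every approval profile. -/
structure ABCRankingRule (m k : ℕ) where
  rel : Profile m → Finset (Fin m) → Finset (Fin m) → Prop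
  total : ∀ A W1 W2, W1.card = k → W2.card = k → rel A W1 W2 ∨ rel A W2 W1
  trans : ∀ A W1 W2 W3, W1.card = k → W2.card = k → W3.card = k →
    rel A W1 W2 → rel A W2 W3 → rel A W1 W3

/-- The strict part of a (weak) relation on committees. -/
def strictOf {ρ : Type} {m : ℕ} (rel : ρ → Finset (Fin m) → Finset (Fin m) → Prop)
    (A : ρ) (W1 W2 : Finset (Fin m)) : Prop :=
  rel A W1 W2 ∧ ¬ rel A W2 W1

def ABCRankingRule.strict {m k : ℕ} (F : ABCRankingRule m k) :
    Profile m → Finset (Fin m) → Finset (Fin m) → Prop :=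
  strictOf F.rel

/-- Anonymity: the outcome depends only on the multiset of ballots. -/
def Anonymous (m k : ℕ) (rel : Profile m → Finset (Fin m) → Finset (Fin m) → Prop) : Prop :=
  ∀ A A' : Profile m, A.Perm A' → ∀ W1 W2 : Finset (Fin m), W1.card = k → W2.card = k →
    (rel A W1 W2 ↔ rel A' W1 W2)

/-- Neutrality: renaming candidates by a permutation renames the outcome accordingly. -/
def Neutral (m k : ℕ) (rel : Profile m → Finset (Fin m) → Finset (Fin m) → Prop) : Prop :=
  ∀ (σ : Equiv.Perm (Fin m)) (A : Profile m) (W1 W2 : Finset (Fin m)),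
    W1.card = k → W2.card = k →
    (rel A W1 W2 ↔ rel (A.map (fun s => s.image σ)) (W1.image σ) (W2.image σ))

/-- Consistency for ABC ranking rules. -/
def Consistent (m k : ℕ) (rel : Profile m → Finset (Fin m) → Finset (Fin m) → Prop) : Prop :=
  ∀ (A A' : Profile m) (W1 W2 : Finset (Fin m)), W1.card = k → W2.card = k →
    (strictOf rel A W1 W2 → rel A' W1 W2 → strictOf rel (A ++ A') W1 W2) ∧
    (rel A W1 W2 → rel A' W1 W2 → rel (A ++ A') W1 W2)

/-- Weak efficiency: if no voter approves any candidate of `W2 \ W1` then `W1 ⪰ W2`. -/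
def WeakEfficient (m k : ℕ) (rel : Profile m → Finset (Fin m) → Finset (Fin m) → Prop) : Prop :=
  ∀ (A : Profile m) (W1 W2 : Finset (Fin m)), W1.card = k → W2.card = k →
    (∀ s ∈ A, ∀ c ∈ W2, c ∉ W1 → c ∉ s) → rel A W1 W2

/-- Efficiency: if every voter approves at least as many members of `W1` as of `W2`
then `W1 ⪰ W2`. -/
def Efficient (m k : ℕ) (rel : Profile m → Finset (Fin m) → Finset (Fin m) → Prop) : Prop :=
  ∀ (A : Profile m) (W1 W2 : Finset (Fin m)), W1.card = k → W2.card = k →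
    (∀ s ∈ A, (s ∩ W2).card ≤ (s ∩ W1).card) → rel A W1 W2

/-- Continuity for ABC ranking rules. -/
def Continuous (m k : ℕ) (rel : Profile m → Finset (Fin m) → Finset (Fin m) → Prop) : Prop :=
  ∀ (A A' : Profile m) (W1 W2 : Finset (Fin m)), W1.card = k → W2.card = k →
    strictOf rel A' W1 W2 → ∃ n : ℕ, strictOf rel (A ++ nCopies n A') W1 W2

/-- A counting function `f` implements an ABC ranking rule `F`. -/
def Implements (m k : ℕ) (f : ℕ → ℕ → ℝ) (F : ABCRankingRule m k) : Prop :=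
  ∀ (A : Profile m) (W1 W2 : Finset (Fin m)), W1.card = k → W2.card = k →
    (score f W2 A < score f W1 A ↔ F.strict A W1 W2)

/-- `F` is an ABC counting rule: some counting function implements it. -/
def IsCountingRule (m k : ℕ) (F : ABCRankingRule m k) : Prop :=
  ∃ f : ℕ → ℕ → ℝ, IsCountingFunction m k f ∧ Implements m k f F

/-- `W` is a winning committee in `F(A)`: it is a maximal element of the weak order. -/
def Winning (m k : ℕ) (F : ABCRankingRule m k) (A : Profile m) (W : Finset (Fin m)) : Prop :=
  W.card = k ∧ ∀ W' : Finset (Fin m), W'.card = k → F.rel A W W'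

/-- `A` is a party-list profile with `p` parties with approval sets `Cs 0, …, Cs (p-1)`:
the `Cs i` are pairwise disjoint nonempty sets, every ballot equals some `Cs i`,
and each party has at least one voter. -/
def IsPartyList (m : ℕ) (A : Profile m) (p : ℕ) (Cs : Fin p → Finset (Fin m)) : Prop :=
  (∀ i, (Cs i).Nonempty) ∧
  (∀ i j, i ≠ j → Disjoint (Cs i) (Cs j)) ∧
  (∀ s ∈ A, ∃ i, s = Cs i) ∧
  (∀ i, Cs i ∈ A)

/-- The number `|N_i|` of voters of party `i`. -/
def partySize {m : ℕ} (A : Profile m) {p : ℕ} (Cs : Fin p → Finset (Fin m)) (i : Fin p) : ℕ :=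
  A.count (Cs i)

/-- `W` is D'Hondt proportional for the party-list profile `A`:
for all parties `i, j`: `C_j ⊆ W`, or `W ∩ C_i = ∅`, or
`|N_i|/|W∩C_i| ≥ |N_j|/(|W∩C_j|+1)` (stated cross-multiplied). -/
def DHondtProportionalFor (m : ℕ) (A : Profile m) (p : ℕ) (Cs : Fin p → Finset (Fin m))
    (W : Finset (Fin m)) : Prop :=
  ∀ i j : Fin p,
    Cs j ⊆ W ∨ W ∩ Cs i = ∅ ∨
    partySize A Cs j * (W ∩ Cs i).card ≤ partySize A Cs i * ((W ∩ Cs j).card + 1)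

/-- D'Hondt proportionality for ABC ranking rules. -/
def DHondtProp (m k : ℕ) (F : ABCRankingRule m k) : Prop :=
  ∀ (A : Profile m) (p : ℕ) (Cs : Fin p → Finset (Fin m)), IsPartyList m A p Cs →
    ∀ W : Finset (Fin m), W.card = k →
      (Winning m k F A W ↔ DHondtProportionalFor m A p Cs W)

/-- The PAV counting function `f_PAV(x,y) = Σ_{i=1}^{x} 1/i`. -/
noncomputable def fPAV : ℕ → ℕ → ℝ := fun x _ => ∑ i ∈ Finset.range x, (1 : ℝ) / (i + 1)

/-- The AV counting function `f_AV(x,y) = x`. -/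
def fAV : ℕ → ℕ → ℝ := fun x _ => (x : ℝ)

/-- The Chamberlin–Courant counting function. -/
noncomputable def fCC : ℕ → ℕ → ℝ := fun x _ => if x = 0 then 0 else 1

/-- The union of all approval sets in a profile. -/
def profileUnion {m : ℕ} (A : Profile m) : Finset (Fin m) := A.foldr (· ∪ ·) ∅

/-- Disjoint equality for ABC ranking rules. -/
def DisjointEquality (m k : ℕ) (F : ABCRankingRule m k) : Prop :=
  ∀ A : Profile m,
    (∀ c : Fin m, A.countP (fun s => decide (c ∈ s)) ≤ 1) →
    k ≤ (profileUnion A).card →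
    ∀ W : Finset (Fin m), W.card = k →
      (Winning m k F A W ↔ W ⊆ profileUnion A)

/-- Disjoint diversity for ABC ranking rules, stated for party-list profiles whose
parties are indexed in order of weakly decreasing size. -/
def DisjointDiversity (m k : ℕ) (F : ABCRankingRule m k) : Prop :=
  ∀ (A : Profile m) (p : ℕ) (Cs : Fin p → Finset (Fin m)), IsPartyList m A p Cs →
    (∀ i j : Fin p, i ≤ j → partySize A Cs j ≤ partySize A Cs i) →
    ∃ W : Finset (Fin m), Winning m k F A W ∧
      ∀ i : Fin p, (i : ℕ) < k → (W ∩ Cs i).Nonempty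

/-- Lower quota for ABC ranking rules. -/
def LowerQuota (m k : ℕ) (F : ABCRankingRule m k) : Prop :=
  ∀ (A : Profile m) (p : ℕ) (Cs : Fin p → Finset (Fin m)), IsPartyList m A p Cs →
    ∀ W : Finset (Fin m), Winning m k F A W →
      ∀ i : Fin p,
        k * partySize A Cs i / A.length ≤ (W ∩ Cs i).card ∨
        (Cs i).card < k * partySize A Cs i / A.length

/-- A trivial ABC ranking rule declares all committees tied on all profiles. -/
def IsTrivialRule (m k : ℕ) (F : ABCRankingRule m k) : Prop :=
  ∀ (A : Profile m) (W1 W2 : Finset (Fin m)), W1.card = k → W2.card = k → F.rel A W1 W2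

/-- An `ℓ`-regular profile: every voter approves exactly `ℓ` candidates. -/
def IsRegular (m ℓ : ℕ) (A : Profile m) : Prop := ∀ s ∈ A, s.card = ℓ

/- ### Linear-order (LOC) profiles -/

/-- A profile of linear orders: each voter's ranking is a bijection sending a
candidate to its position (position `0` is the top). -/
abbrev LProfile (m : ℕ) := List (Fin m ≃ Fin m)

def nCopiesL {m : ℕ} (n : ℕ) (P : LProfile m) : LProfile m := (List.replicate n P).flatten

/-- The set of a voter's top `ℓ` candidates. -/
def apprTop (m ℓ : ℕ) (r : Fin m ≃ Fin m) : Finset (Fin m) :=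
  Finset.univ.filter (fun c => (r c : ℕ) < ℓ)

/-- `Appr(P, ℓ)`: the approval profile in which each voter approves her top `ℓ`
candidates. -/
def ApprProfile (m ℓ : ℕ) (P : LProfile m) : Profile m := P.map (apprTop m ℓ)

def LAnonymous (m k : ℕ) (rel : LProfile m → Finset (Fin m) → Finset (Fin m) → Prop) : Prop :=
  ∀ P P' : LProfile m, P.Perm P' → ∀ W1 W2 : Finset (Fin m), W1.card = k → W2.card = k →
    (rel P W1 W2 ↔ rel P' W1 W2)

def LNeutral (m k : ℕ) (rel : LProfile m → Finset (Fin m) → Finset (Fin m) → Prop) : Prop :=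
  ∀ (σ : Equiv.Perm (Fin m)) (P : LProfile m) (W1 W2 : Finset (Fin m)),
    W1.card = k → W2.card = k →
    (rel P W1 W2 ↔ rel (P.map (fun r => σ.symm.trans r)) (W1.image σ) (W2.image σ))

def LConsistent (m k : ℕ) (rel : LProfile m → Finset (Fin m) → Finset (Fin m) → Prop) : Prop :=
  ∀ (P P' : LProfile m) (W1 W2 : Finset (Fin m)), W1.card = k → W2.card = k →
    (strictOf rel P W1 W2 → rel P' W1 W2 → strictOf rel (P ++ P') W1 W2) ∧
    (rel P W1 W2 → rel P' W1 W2 → rel (P ++ P') W1 W2)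

def LContinuous (m k : ℕ) (rel : LProfile m → Finset (Fin m) → Finset (Fin m) → Prop) : Prop :=
  ∀ (P P' : LProfile m) (W1 W2 : Finset (Fin m)), W1.card = k → W2.card = k →
    strictOf rel P' W1 W2 → ∃ n : ℕ, strictOf rel (P ++ nCopiesL n P') W1 W2

/-- `I` dominates `J`: sorted increasingly, the `t`-th element of `I` is at most
the `t`-th element of `J`. -/
def dominatesPos (m : ℕ) (I J : Finset (Fin m)) : Prop :=
  List.Forall₂ (· ≤ ·) (I.sort (· ≤ ·)) (J.sort (· ≤ ·))

/-- Committee dominance for LOC ranking rules. -/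
def LCommitteeDominance (m k : ℕ)
    (rel : LProfile m → Finset (Fin m) → Finset (Fin m) → Prop) : Prop :=
  ∀ (P : LProfile m) (W1 W2 : Finset (Fin m)), W1.card = k → W2.card = k →
    (∀ r ∈ P, dominatesPos m (W1.image ⇑r) (W2.image ⇑r)) → rel P W1 W2

/- ### ABC choice rules -/

/-- An ABC choice rule: a nonempty set of winning committees for every profile. -/
structure ABCChoiceRule (m k : ℕ) where
  choice : Profile m → Set (Finset (Fin m))
  nonempty : ∀ A, (choice A).Nonempty
  card_eq : ∀ A W, W ∈ choice A → W.card = k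

def CAnonymous (m k : ℕ) (R : ABCChoiceRule m k) : Prop :=
  ∀ A A' : Profile m, A.Perm A' → R.choice A = R.choice A'

def CNeutral (m k : ℕ) (R : ABCChoiceRule m k) : Prop :=
  ∀ (σ : Equiv.Perm (Fin m)) (A : Profile m),
    R.choice (A.map (fun s => s.image σ)) = (fun W : Finset (Fin m) => W.image σ) '' R.choice A

def CConsistent (m k : ℕ) (R : ABCChoiceRule m k) : Prop :=
  ∀ A A' : Profile m, (R.choice A ∩ R.choice A').Nonempty →
    R.choice (A ++ A') = R.choice A ∩ R.choice A'

def CContinuous (m k : ℕ) (R : ABCChoiceRule m k) : Prop :=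
  ∀ A A' : Profile m, R.choice A ∩ R.choice A' = ∅ →
    ∃ n : ℕ, R.choice (A ++ nCopies n A') ⊆ R.choice A'

def CWeakEfficient (m k : ℕ) (R : ABCChoiceRule m k) : Prop :=
  ∀ (A : Profile m) (W : Finset (Fin m)), W ∈ R.choice A →
    ∀ c ∈ W, (∀ s ∈ A, c ∉ s) →
      ∀ c' : Fin m, c' ∉ W → insert c' (W.erase c) ∈ R.choice A

def TwoNonimposition (m k : ℕ) (R : ABCChoiceRule m k) : Prop :=
  ∀ W1 W2 : Finset (Fin m), W1.card = k → W2.card = k →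
    ∃ B : Profile m, R.choice B = {W1, W2}

/-- The ranking-side relation `F_R` induced by a choice rule `R` and a map `α`. -/
def relFR (m k : ℕ) (R : ABCChoiceRule m k)
    (α : Finset (Fin m) → Finset (Fin m) → Profile m)
    (A : Profile m) (W1 W2 : Finset (Fin m)) : Prop :=
  ∃ n : ℕ, ∀ n' ≥ n, W1 ∈ R.choice (A ++ nCopies n' (α W1 W2))

def CDHondtProp (m k : ℕ) (R : ABCChoiceRule m k) : Prop :=
  ∀ (A : Profile m) (p : ℕ) (Cs : Fin p → Finset (Fin m)), IsPartyList m A p Cs →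
    ∀ W : Finset (Fin m), W.card = k →
      (W ∈ R.choice A ↔ DHondtProportionalFor m A p Cs W)

def CDisjointDiversity (m k : ℕ) (R : ABCChoiceRule m k) : Prop :=
  ∀ (A : Profile m) (p : ℕ) (Cs : Fin p → Finset (Fin m)), IsPartyList m A p Cs →
    (∀ i j : Fin p, i ≤ j → partySize A Cs j ≤ partySize A Cs i) →
    ∃ W ∈ R.choice A, ∀ i : Fin p, (i : ℕ) < k → (W ∩ Cs i).Nonempty

/-- A trivial ABC choice rule returns all committees on every profile. -/
def CTrivial (m k : ℕ) (R : ABCChoiceRule m k) : Prop :=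
  ∀ A : Profile m, R.choice A = {W : Finset (Fin m) | W.card = k}


section Choice

variable {m k : ℕ} {R : ABCChoiceRule m k}

/-- The properties characterizing Approval Chamberlin–Courant among choice rules. -/
structure ChoicePostulates (R : ABCChoiceRule m k) : Prop where
  anon : CAnonymous m k R
  neut : CNeutral m k R
  cons : CConsistent m k R
  weff : CWeakEfficient m k R
  cont : CContinuous m k R
  div : CDisjointDiversity m k R

/-- Two committees are tied in `A` if some profile electing both still elects both
after adding `A`. -/
def Tied (R : ABCChoiceRule m k) (W W' : Finset (Fin m)) (A : Profile m) : Prop :=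
  ∃ B, W ∈ R.choice B ∧ W' ∈ R.choice B ∧ W ∈ R.choice (A ++ B) ∧ W' ∈ R.choice (A ++ B)

/-- The profile with one singleton ballot for each member of `T`. -/
noncomputable def singles (T : Finset (Fin m)) : Profile m := T.toList.map fun c => {c}

lemma mem_singles {T s : Finset (Fin m)} : s ∈ singles T ↔ ∃ c ∈ T, s = {c} := by
  simp [singles, eq_comm]

lemma nodup_singles (T : Finset (Fin m)) : (singles T).Nodup :=
  T.nodup_toList.map Finset.singleton_injective

lemma pairwise_disjoint_singles (T : Finset (Fin m)) : (singles T).Pairwise Disjoint := by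
  refine List.pairwise_map.2 (T.nodup_toList.imp ?_)
  intro a b h
  simpa using h

lemma length_singles (T : Finset (Fin m)) : (singles T).length = T.card := by
  simp [singles]

lemma nCopies_succ (n : ℕ) (A : Profile m) : nCopies (n + 1) A = A ++ nCopies n A := by
  simp [nCopies, List.replicate_succ]

lemma count_nCopies (n : ℕ) (A : Profile m) (s : Finset (Fin m)) :
    (nCopies n A).count s = n * A.count s := by
  induction n with
  | zero => simp [nCopies]
  | succ n ih => rw [nCopies_succ, List.count_append, ih]; ring

lemma mem_nCopies {n : ℕ} (hn : n ≠ 0) {A : Profile m} {s : Finset (Fin m)} :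
    s ∈ nCopies n A ↔ s ∈ A := by
  simp [nCopies, List.mem_flatten, List.mem_replicate, hn]

/-- A permutation of the candidates preserving `s` and moving `V` to `W` exists as soon as
`V` and `W` have the same size inside and outside `s`. -/
lemma exists_perm_image {s V W : Finset (Fin m)} (hc : V.card = W.card)
    (hs : (V ∩ s).card = (W ∩ s).card) :
    ∃ σ : Equiv.Perm (Fin m), s.image σ = s ∧ V.image σ = W := by
  have key : ∀ c : Bool × Bool,
      Nonempty ({a // (decide (a ∈ s), decide (a ∈ V)) = c} ≃
        {a // (decide (a ∈ s), decide (a ∈ W)) = c}) := by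
    intro c
    refine ⟨Fintype.equivOfCardEq ?_⟩
    have h1 := Finset.card_sdiff_add_card_inter V s
    have h2 := Finset.card_sdiff_add_card_inter W s
    have h3 := Finset.card_sdiff_add_card_inter s V
    have h4 := Finset.card_sdiff_add_card_inter s W
    have h5 := Finset.card_union_add_card_inter V s
    have h6 := Finset.card_union_add_card_inter W s
    have h7 := Finset.card_compl_add_card (V ∪ s)
    have h8 := Finset.card_compl_add_card (W ∪ s)
    rw [Finset.inter_comm] at h3 h4
    rw [Fintype.card_subtype, Fintype.card_subtype]
    obtain ⟨c1, c2⟩ := c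
    cases c1 <;> cases c2
    · have e (U : Finset (Fin m)) : Finset.univ.filter
          (fun a => (decide (a ∈ s), decide (a ∈ U)) = (false, false)) = (U ∪ s)ᶜ := by
        ext a; simp; tauto
      rw [e, e]; omega
    · have e (U : Finset (Fin m)) : Finset.univ.filter
          (fun a => (decide (a ∈ s), decide (a ∈ U)) = (false, true)) = U \ s := by
        ext a; simp; tauto
      rw [e, e]; omega
    · have e (U : Finset (Fin m)) : Finset.univ.filter
          (fun a => (decide (a ∈ s), decide (a ∈ U)) = (true, false)) = s \ U := by
        ext a; simp
      rw [e, e]; omega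
    · have e (U : Finset (Fin m)) : Finset.univ.filter
          (fun a => (decide (a ∈ s), decide (a ∈ U)) = (true, true)) = U ∩ s := by
        ext a; simp; tauto
      rw [e, e]; omega
  let e := fun c => (key c).some
  have hσ := Equiv.ofFiberEquiv_map (f := fun a => (decide (a ∈ s), decide (a ∈ V)))
    (g := fun a => (decide (a ∈ s), decide (a ∈ W))) e
  set σ : Equiv.Perm (Fin m) := Equiv.ofFiberEquiv e
  simp only [Prod.mk.injEq, decide_eq_decide] at hσ
  refine ⟨σ, ?_, ?_⟩
  · ext a
    obtain ⟨b, rfl⟩ := σ.surjective a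
    simp [(hσ b).1]
  · ext a
    obtain ⟨b, rfl⟩ := σ.surjective a
    simp [(hσ b).2]

namespace ChoicePostulates

lemma image_mem (h : ChoicePostulates R) {A : Profile m} {W : Finset (Fin m)}
    (hW : W ∈ R.choice A) (σ : Equiv.Perm (Fin m))
    (hσ : (A.map fun s => s.image σ).Perm A) : W.image σ ∈ R.choice A := by
  rw [← h.anon _ _ hσ, h.neut]
  exact ⟨W, hW, rfl⟩

lemma mem_nil (h : ChoicePostulates R) {W : Finset (Fin m)} (hW : W.card = k) :
    W ∈ R.choice [] := by
  obtain ⟨V, hV⟩ := R.nonempty []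
  obtain ⟨σ, -, rfl⟩ := exists_perm_image (s := ∅) (V := V) (W := W)
    ((R.card_eq _ _ hV).trans hW.symm) (by simp)
  exact h.image_mem hV σ (by simp)

lemma mem_append_iff (h : ChoicePostulates R) {A B : Profile m} {W V : Finset (Fin m)}
    (hA : W ∈ R.choice A) (hB : W ∈ R.choice B) :
    V ∈ R.choice (A ++ B) ↔ V ∈ R.choice A ∧ V ∈ R.choice B := by
  rw [h.cons A B ⟨W, hA, hB⟩]; rfl

lemma mem_append (h : ChoicePostulates R) {A B : Profile m} {W : Finset (Fin m)}
    (hA : W ∈ R.choice A) (hB : W ∈ R.choice B) : W ∈ R.choice (A ++ B) :=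
  (h.mem_append_iff hA hB).2 ⟨hA, hB⟩

lemma mem_nCopies (h : ChoicePostulates R) {A : Profile m} {W : Finset (Fin m)}
    (hA : W ∈ R.choice A) (n : ℕ) : W ∈ R.choice (nCopies n A) := by
  induction n with
  | zero => exact h.mem_nil (R.card_eq _ _ hA)
  | succ n ih => rw [nCopies_succ]; exact h.mem_append hA ih

/-- If some committee is elected by every single ballot of `A`, then `A` elects exactly the
committees with this property. -/
lemma mem_iff_forall (h : ChoicePostulates R) {A : Profile m} {W V : Finset (Fin m)}
    (hW : W.card = k) (hA : ∀ s ∈ A, W ∈ R.choice [s]) :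
    V ∈ R.choice A ↔ V.card = k ∧ ∀ s ∈ A, V ∈ R.choice [s] := by
  induction A generalizing V with
  | nil => simpa using ⟨fun hV => R.card_eq _ _ hV, fun hV => h.mem_nil hV⟩
  | cons s A ih =>
    have ih' := fun V => ih (V := V) fun t ht => hA t (List.mem_cons_of_mem _ ht)
    rw [← List.singleton_append, h.mem_append_iff (hA s (by simp))
      ((ih' W).2 ⟨hW, fun t ht => hA t (List.mem_cons_of_mem _ ht)⟩), ih']
    simp only [List.singleton_append, List.forall_mem_cons]
    tauto

lemma exists_choice_append_nCopies_subset (h : ChoicePostulates R) (A B : Profile m) :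
    ∃ n ≠ 0, R.choice (A ++ nCopies n B) ⊆ R.choice B := by
  rcases Set.eq_empty_or_nonempty (R.choice A ∩ R.choice B) with he | hne
  · obtain ⟨n, hn⟩ := h.cont A B he
    obtain ⟨V, hV⟩ := R.nonempty (A ++ nCopies n B)
    refine ⟨n + 1, by omega, ?_⟩
    rw [nCopies_succ, h.anon _ (B ++ (A ++ nCopies n B)) ?_, h.cons _ _ ⟨V, hn hV, hV⟩]
    · exact Set.inter_subset_left
    · rw [← List.append_assoc, ← List.append_assoc]
      exact List.perm_append_comm.append_right _
  · refine ⟨1, one_ne_zero, ?_⟩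
    rw [show nCopies 1 B = B by simp [nCopies], h.cons _ _ hne]
    exact Set.inter_subset_right

/-- Disjoint diversity for parties given by a list of ballots. -/
lemma exists_mem_of_parties (h : ChoicePostulates R) {L : List (Finset (Fin m))} {A : Profile m}
    (hne : ∀ s ∈ L, s.Nonempty) (hd : L.Pairwise Disjoint) (hA : ∀ s, s ∈ A ↔ s ∈ L)
    (hc : L.Pairwise fun s t => A.count t ≤ A.count s) :
    ∃ W ∈ R.choice A, ∀ s ∈ L.take k, (W ∩ s).Nonempty := by
  rw [List.pairwise_iff_get] at hd hc
  have hparty : IsPartyList m A L.length L.get := by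
    refine ⟨fun i => hne _ (L.get_mem i), fun i j hij => ?_, fun s hs => ?_, fun i => ?_⟩
    · rcases lt_or_gt_of_ne hij with hlt | hlt
      · exact hd _ _ hlt
      · exact (hd _ _ hlt).symm
    · obtain ⟨i, hi⟩ := List.get_of_mem ((hA s).1 hs)
      exact ⟨i, hi.symm⟩
    · exact (hA _).2 (L.get_mem i)
  have hsize : ∀ i j, i ≤ j → partySize A L.get j ≤ partySize A L.get i := by
    intro i j hij
    rcases hij.eq_or_lt with rfl | hlt
    · rfl
    · exact hc _ _ hlt
  obtain ⟨W, hW, hWs⟩ := h.div A L.length L.get hparty hsize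
  refine ⟨W, hW, fun s hs => ?_⟩
  obtain ⟨i, hi, rfl⟩ := List.mem_take_iff_getElem.1 hs
  exact hWs ⟨i, by omega⟩ (by simp; omega)

/-- The committees elected by a single ballot are upward closed in the number of their
approved members. -/
lemma mem_singleton_of_le (h : ChoicePostulates R) {s V W : Finset (Fin m)}
    (hV : V ∈ R.choice [s]) (hW : W.card = k) (hle : (V ∩ s).card ≤ (W ∩ s).card) :
    W ∈ R.choice [s] := by
  obtain ⟨n, hn⟩ := Nat.exists_eq_add_of_le hle
  have hVk := R.card_eq _ _ hV
  clear hle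
  induction n generalizing V with
  | zero =>
    obtain ⟨σ, hs, rfl⟩ := exists_perm_image (hVk.trans hW.symm) hn.symm
    exact h.image_mem hV σ (by simp [hs])
  | succ n ih =>
    have h1 := Finset.card_sdiff_add_card_inter V s
    have h2 := Finset.card_sdiff_add_card_inter W s
    have h3 := Finset.card_sdiff_add_card_inter s V
    have h4 := Finset.card_le_card (Finset.inter_subset_right : W ∩ s ⊆ s)
    rw [Finset.inter_comm] at h3
    obtain ⟨c, hc⟩ : (V \ s).Nonempty := Finset.card_pos.1 (by omega)
    obtain ⟨c', hc'⟩ : (s \ V).Nonempty := Finset.card_pos.1 (by omega)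
    rw [Finset.mem_sdiff] at hc hc'
    have hmem := h.weff [s] V hV c hc.1 (by simpa using hc.2) c' hc'.2
    refine ih hmem ?_ (R.card_eq _ _ hmem)
    have he : insert c' (V.erase c) ∩ s = insert c' (V ∩ s) := by
      ext a
      simp only [Finset.mem_inter, Finset.mem_insert, Finset.mem_erase]
      constructor
      · rintro ⟨rfl | h1, h2⟩ <;> tauto
      · rintro (rfl | ⟨h1, h2⟩)
        · tauto
        · exact ⟨Or.inr ⟨fun e => hc.2 (e ▸ h2), h1⟩, h2⟩
    rw [he, Finset.card_insert_of_notMem (by simp [hc'.2])]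
    omega

lemma mem_singleton_of_inter (h : ChoicePostulates R) (hk : 0 < k) {s W : Finset (Fin m)}
    (hW : W.card = k) (hs : (W ∩ s).Nonempty) : W ∈ R.choice [s] := by
  obtain ⟨T, hTs, hTc⟩ := Finset.exists_subset_card_eq (s := sᶜ) (n := min (k - 1) sᶜ.card)
    (min_le_right _ _)
  have hsT : ∀ c ∈ T, c ∉ s := fun c hc => by simpa using hTs hc
  obtain ⟨n, hn, hsub⟩ := h.exists_choice_append_nCopies_subset (singles T) [s]
  have hnot : ∀ t ∈ singles T, Disjoint s t := by
    intro t ht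
    obtain ⟨c, hc, rfl⟩ := mem_singles.1 ht
    simpa using hsT c hc
  have hsne : s.Nonempty := hs.mono Finset.inter_subset_right
  have hnotmem : s ∉ singles T := fun hm => by
    simpa using hsne.ne_empty (disjoint_self.1 (hnot s hm))
  have hcount : ∀ t ∈ singles T, (singles T ++ nCopies n [s]).count t = 1 := by
    intro t ht
    have hne : s ≠ t := fun e => hnotmem (e ▸ ht)
    rw [List.count_append, count_nCopies, List.count_eq_one_of_mem (nodup_singles T) ht]
    simp [hne]
  have hV : ∃ V ∈ R.choice (singles T ++ nCopies n [s]),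
      ∀ t ∈ (s :: singles T).take k, (V ∩ t).Nonempty := by
    apply h.exists_mem_of_parties
    · rintro t ht
      rcases List.mem_cons.1 ht with rfl | ht
      · exact hsne
      · obtain ⟨c, hc, rfl⟩ := mem_singles.1 ht
        exact Finset.singleton_nonempty c
    · exact List.pairwise_cons.2 ⟨hnot, pairwise_disjoint_singles T⟩
    · intro t
      simp [ABC.mem_nCopies hn, or_comm]
    · refine List.pairwise_cons.2 ⟨fun t ht => ?_, ?_⟩
      · rw [hcount t ht, List.count_append, count_nCopies]
        simp; omega
      · exact List.pairwise_of_forall_mem_list fun t ht t' ht' =>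
          ((hcount t' ht').trans (hcount t ht).symm).le
  obtain ⟨V, hV, hVs⟩ := hV
  rw [List.take_of_length_le (by simp [length_singles, hTc]; omega)] at hVs
  have hTV : T ⊆ V \ s := by
    intro c hc
    obtain ⟨a, ha⟩ := hVs {c} (List.mem_cons_of_mem _ (mem_singles.2 ⟨c, hc, rfl⟩))
    simp only [Finset.mem_inter, Finset.mem_singleton] at ha
    obtain ⟨ha, rfl⟩ := ha
    exact Finset.mem_sdiff.2 ⟨ha, hsT _ hc⟩
  refine h.mem_singleton_of_le (hsub hV) hW ?_
  have h0 := Finset.card_le_card hTV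
  have h1 := Finset.card_sdiff_add_card_inter V s
  have h2 := Finset.card_sdiff_add_card_inter W s
  have h3 : (W \ s).card ≤ sᶜ.card := Finset.card_le_card (by intro a; simp)
  have h4 := hs.card_pos
  have h5 := R.card_eq _ _ hV
  omega

lemma exists_mem_of_disjoint_parties (h : ChoicePostulates R) {A : Profile m}
    (hne : ∀ s ∈ A, s.Nonempty) (hd : A.Pairwise Disjoint) :
    ∃ W ∈ R.choice A, ∀ s ∈ A.take k, (W ∩ s).Nonempty := by
  have hnd : A.Nodup := hd.imp_of_mem fun {a b} ha _ hab e => by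
    subst e
    exact (hne a ha).ne_empty (disjoint_self.1 hab)
  refine h.exists_mem_of_parties hne hd (fun s => Iff.rfl) ?_
  exact List.pairwise_of_forall_mem_list fun s hs t ht =>
    ((List.count_eq_one_of_mem hnd ht).trans (List.count_eq_one_of_mem hnd hs).symm).le

lemma subset_of_forall_singles {T W : Finset (Fin m)}
    (hW : ∀ s ∈ singles T, (W ∩ s).Nonempty) : T ⊆ W := by
  intro c hc
  obtain ⟨a, ha⟩ := hW {c} (mem_singles.2 ⟨c, hc, rfl⟩)
  simp only [Finset.mem_inter, Finset.mem_singleton] at ha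
  exact ha.2 ▸ ha.1

lemma nonempty_of_mem_singles {T s : Finset (Fin m)} (hs : s ∈ singles T) : s.Nonempty := by
  obtain ⟨c, -, rfl⟩ := mem_singles.1 hs
  exact Finset.singleton_nonempty c

lemma disjoint_of_mem_singles {T s t : Finset (Fin m)} (hT : Disjoint T s)
    (ht : t ∈ singles T) : Disjoint t s := by
  obtain ⟨c, hc, rfl⟩ := mem_singles.1 ht
  exact Finset.disjoint_singleton_left.2 (Finset.disjoint_left.1 hT hc)

lemma mem_singleton_of_mem_of_disjoint (h : ChoicePostulates R) {s V W : Finset (Fin m)}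
    (hV : V ∈ R.choice [s]) (hVs : Disjoint V s) (hW : W.card = k) : W ∈ R.choice [s] :=
  h.mem_singleton_of_le hV hW (by simp [Finset.disjoint_iff_inter_eq_empty.1 hVs])

lemma exists_notMem_singleton (h : ChoicePostulates R) (hk : 0 < k) (hkm : k < m)
    (hnt : ¬ CTrivial m k R) :
    ∃ s W : Finset (Fin m), s.Nonempty ∧ W.card = k ∧ Disjoint W s ∧ W ∉ R.choice [s] := by
  by_contra! hcon
  refine hnt fun A => ?_
  have hall : ∀ s W : Finset (Fin m), W.card = k → W ∈ R.choice [s] := by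
    intro s W hW
    rcases s.eq_empty_or_nonempty with rfl | hs
    · obtain ⟨V, hV⟩ := R.nonempty [∅]
      exact h.mem_singleton_of_le hV hW (by simp)
    · by_cases hd : Disjoint W s
      · exact hcon s W hs hW hd
      · exact h.mem_singleton_of_inter hk hW (Finset.not_disjoint_iff_nonempty_inter.1 hd)
  obtain ⟨W, -, hW⟩ := Finset.exists_subset_card_eq
    (s := (Finset.univ : Finset (Fin m))) (n := k) (by simpa using hkm.le)
  ext V
  rw [h.mem_iff_forall hW fun s _ => hall s W hW]
  exact ⟨fun hV => hV.1, fun hV => ⟨hV, fun s _ => hall s V hV⟩⟩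

lemma notMem_singleton_singleton (h : ChoicePostulates R) (hk : 0 < k) (hkm : k < m)
    (hnt : ¬ CTrivial m k R) {c : Fin m} {W : Finset (Fin m)} (hcW : c ∉ W) :
    W ∉ R.choice [{c}] := by
  intro hmem
  have hall : ∀ (d : Fin m) (V : Finset (Fin m)), V.card = k → V ∈ R.choice [{d}] := by
    intro d V hV
    have h1 : V.image (Equiv.swap c d) ∈ R.choice [{c}] :=
      h.mem_singleton_of_mem_of_disjoint hmem (by simpa using hcW)
        (by rw [Finset.card_image_of_injective _ (Equiv.injective _), hV])
    have h2 := h.neut (Equiv.swap c d) [{c}]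
    simp only [List.map_cons, List.map_nil, Finset.image_singleton, Equiv.swap_apply_left] at h2
    rw [h2]
    refine ⟨_, h1, ?_⟩
    ext a
    simp [Finset.image_image]
  obtain ⟨s, U, hs, hU, hUs, hnot⟩ := h.exists_notMem_singleton hk hkm hnt
  obtain ⟨V, hV, hVs⟩ := h.exists_mem_of_disjoint_parties (A := singles U ++ [s])
    (by
      intro t ht
      rcases List.mem_append.1 ht with ht | ht
      · exact nonempty_of_mem_singles ht
      · rwa [List.mem_singleton.1 ht])
    (List.pairwise_append.2 ⟨pairwise_disjoint_singles U, List.pairwise_singleton _ _,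
      fun t ht s' hs' => List.mem_singleton.1 hs' ▸ disjoint_of_mem_singles hUs ht⟩)
  rw [List.take_left' (by rw [length_singles, hU])] at hVs
  have hVk := R.card_eq _ _ hV
  obtain rfl := Finset.eq_of_subset_of_card_le (subset_of_forall_singles hVs) (by omega)
  have hsing : ∀ V : Finset (Fin m), V.card = k → V ∈ R.choice (singles U) := by
    intro V hV
    refine (h.mem_iff_forall hV ?_).2 ⟨hV, ?_⟩ <;>
    · intro t ht
      obtain ⟨c, hc, rfl⟩ := mem_singles.1 ht
      exact hall c V hV
  obtain ⟨X, hX⟩ := R.nonempty [s]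
  exact hnot ((h.mem_append_iff (hsing X (R.card_eq _ _ hX)) hX).1 hV).2

lemma mem_singleton_iff (h : ChoicePostulates R) (hk : 0 < k) (hkm : k < m)
    (hnt : ¬ CTrivial m k R) {s W : Finset (Fin m)} (hs : s.Nonempty) :
    W ∈ R.choice [s] ↔ W.card = k ∧ (W ∩ s).Nonempty := by
  refine ⟨fun hW => ⟨R.card_eq _ _ hW, ?_⟩, fun hW => h.mem_singleton_of_inter hk hW.1 hW.2⟩
  have hWk := R.card_eq _ _ hW
  rw [← Finset.not_disjoint_iff_nonempty_inter]
  intro hd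
  have hall : ∀ V : Finset (Fin m), V.card = k → V ∈ R.choice [s] := fun V hV =>
    h.mem_singleton_of_mem_of_disjoint hW hd hV
  have hself : W ∈ R.choice (singles W) := by
    refine (h.mem_iff_forall hWk ?_).2 ⟨hWk, ?_⟩ <;>
    · intro t ht
      obtain ⟨c, hc, rfl⟩ := mem_singles.1 ht
      exact h.mem_singleton_of_inter hk hWk ⟨c, by simpa using hc⟩
  obtain ⟨V, hV, hVs⟩ := h.exists_mem_of_disjoint_parties (A := s :: singles W)
    (by
      intro t ht
      rcases List.mem_cons.1 ht with rfl | ht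
      · exact hs
      · exact nonempty_of_mem_singles ht)
    (List.pairwise_cons.2 ⟨fun t ht => (disjoint_of_mem_singles hd ht).symm,
      pairwise_disjoint_singles W⟩)
  have hVW := ((h.mem_append_iff (A := [s]) hW hself).1 hV).2
  rw [h.mem_iff_forall hWk fun t ht => ?_] at hVW
  · have hsub : W ⊆ V := by
      intro c hc
      by_contra hcV
      exact h.notMem_singleton_singleton hk hkm hnt hcV (hVW.2 _ (mem_singles.2 ⟨c, hc, rfl⟩))
    obtain rfl := Finset.eq_of_subset_of_card_le hsub (by omega)
    have := hVs s (by cases k <;> simp_all)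
    exact Finset.not_disjoint_iff_nonempty_inter.2 this hd
  · obtain ⟨c, hc, rfl⟩ := mem_singles.1 ht
    exact h.mem_singleton_of_inter hk hWk ⟨c, by simpa using hc⟩

end ChoicePostulates

namespace Tied

variable {W W' W'' : Finset (Fin m)} {A A' : Profile m}

lemma symm (t : Tied R W W' A) : Tied R W' W A := by
  obtain ⟨B, h1, h2, h3, h4⟩ := t
  exact ⟨B, h2, h1, h4, h3⟩

lemma of_mem (h : ChoicePostulates R) (hW : W ∈ R.choice A) (hW' : W' ∈ R.choice A) :
    Tied R W W' A :=
  ⟨[], h.mem_nil (R.card_eq _ _ hW), h.mem_nil (R.card_eq _ _ hW'), by simpa, by simpa⟩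

lemma perm (h : ChoicePostulates R) (t : Tied R W W' A) (hp : A.Perm A') : Tied R W W' A' := by
  obtain ⟨B, h1, h2, h3, h4⟩ := t
  rw [h.anon _ _ (hp.append_right B)] at h3 h4
  exact ⟨B, h1, h2, h3, h4⟩

lemma append (h : ChoicePostulates R) (t : Tied R W W' A) (t' : Tied R W W' A') :
    Tied R W W' (A ++ A') := by
  obtain ⟨B, h1, h2, h3, h4⟩ := t
  obtain ⟨B', h1', h2', h3', h4'⟩ := t'
  have hp : ((A ++ B) ++ (A' ++ B')).Perm ((A ++ A') ++ (B ++ B')) := by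
    simp only [List.append_assoc]
    refine List.Perm.append_left A ?_
    rw [← List.append_assoc, ← List.append_assoc]
    exact List.perm_append_comm.append_right B'
  exact ⟨B ++ B', h.mem_append h1 h1', h.mem_append h2 h2',
    h.anon _ _ hp ▸ h.mem_append h3 h3', h.anon _ _ hp ▸ h.mem_append h4 h4'⟩

lemma of_append (h : ChoicePostulates R) (t : Tied R W W' (A ++ A')) (t' : Tied R W W' A') :
    Tied R W W' A := by
  obtain ⟨B, h1, h2, h3, h4⟩ := t
  obtain ⟨B', h1', h2', h3', h4'⟩ := t'
  have hp : ((A ++ A' ++ B) ++ B').Perm (A ++ (B ++ (A' ++ B'))) := by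
    simp only [List.append_assoc]
    refine List.Perm.append_left A ?_
    rw [← List.append_assoc, ← List.append_assoc]
    exact List.perm_append_comm.append_right B'
  exact ⟨B ++ (A' ++ B'), h.mem_append h1 h3', h.mem_append h2 h4',
    h.anon _ _ hp ▸ h.mem_append h3 h1', h.anon _ _ hp ▸ h.mem_append h4 h2'⟩

lemma mem (h : ChoicePostulates R) (t : Tied R W W' A) (hW : W ∈ R.choice A) :
    W' ∈ R.choice A := by
  obtain ⟨B, h1, h2, h3, h4⟩ := t
  exact ((h.mem_append_iff hW h1).1 h4).1

lemma nCopies (h : ChoicePostulates R) (hW : W.card = k) (hW' : W'.card = k)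
    (t : Tied R W W' A) (n : ℕ) : Tied R W W' (nCopies n A) := by
  induction n with
  | zero => exact of_mem h (h.mem_nil hW) (h.mem_nil hW')
  | succ n ih => rw [nCopies_succ]; exact t.append h ih

end Tied

namespace ChoicePostulates

lemma exists_mem_notMem_of_ne {V W : Finset (Fin m)} (hc : V.card = W.card) (hne : V ≠ W) :
    ∃ u ∈ W, u ∉ V := by
  by_contra! hsub
  exact hne (Finset.eq_of_subset_of_card_le hsub hc.le).symm

/-- For any three committees some profile elects exactly these. -/
lemma exists_choice_eq_triple (h : ChoicePostulates R) (hk : 0 < k) (hkm : k < m)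
    (hnt : ¬ CTrivial m k R) {W₁ W₂ W₃ : Finset (Fin m)}
    (h₁ : W₁.card = k) (h₂ : W₂.card = k) (h₃ : W₃.card = k) :
    ∃ B : Profile m, ∀ V, V ∈ R.choice B ↔ V = W₁ ∨ V = W₂ ∨ V = W₃ := by
  classical
  let F : Finset (Finset (Fin m)) := Finset.univ.filter fun t =>
    (W₁ ∩ t).Nonempty ∧ (W₂ ∩ t).Nonempty ∧ (W₃ ∩ t).Nonempty
  have hF : ∀ t, t ∈ F.toList ↔
      (W₁ ∩ t).Nonempty ∧ (W₂ ∩ t).Nonempty ∧ (W₃ ∩ t).Nonempty := by simp [F]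
  refine ⟨F.toList, fun V => ?_⟩
  rw [h.mem_iff_forall h₁ fun t ht => h.mem_singleton_of_inter hk h₁ ((hF t).1 ht).1]
  constructor
  · rintro ⟨hVk, hV⟩
    by_contra! hne
    obtain ⟨u₁, hu₁, hv₁⟩ := exists_mem_notMem_of_ne (hVk.trans h₁.symm) hne.1
    obtain ⟨u₂, hu₂, hv₂⟩ := exists_mem_notMem_of_ne (hVk.trans h₂.symm) hne.2.1
    obtain ⟨u₃, hu₃, hv₃⟩ := exists_mem_notMem_of_ne (hVk.trans h₃.symm) hne.2.2
    have hmem := hV {u₁, u₂, u₃} ((hF _).2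
      ⟨⟨u₁, by simp [hu₁]⟩, ⟨u₂, by simp [hu₂]⟩, ⟨u₃, by simp [hu₃]⟩⟩)
    obtain ⟨a, ha⟩ := ((h.mem_singleton_iff hk hkm hnt (by simp)).1 hmem).2
    simp only [Finset.mem_inter, Finset.mem_insert, Finset.mem_singleton] at ha
    obtain ⟨ha, rfl | rfl | rfl⟩ := ha <;> contradiction
  · rintro (rfl | rfl | rfl)
    · exact ⟨h₁, fun t ht => h.mem_singleton_of_inter hk h₁ ((hF t).1 ht).1⟩
    · exact ⟨h₂, fun t ht => h.mem_singleton_of_inter hk h₂ ((hF t).1 ht).2.1⟩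
    · exact ⟨h₃, fun t ht => h.mem_singleton_of_inter hk h₃ ((hF t).1 ht).2.2⟩

lemma tied_trans (h : ChoicePostulates R) (hk : 0 < k) (hkm : k < m) (hnt : ¬ CTrivial m k R)
    {W₁ W₂ W₃ : Finset (Fin m)} {A : Profile m}
    (h₁ : W₁.card = k) (h₂ : W₂.card = k) (h₃ : W₃.card = k)
    (t : Tied R W₁ W₂ A) (t' : Tied R W₂ W₃ A) : Tied R W₁ W₃ A := by
  obtain ⟨B, hB⟩ := h.exists_choice_eq_triple hk hkm hnt h₁ h₂ h₃
  obtain ⟨n, -, hn⟩ := h.exists_choice_append_nCopies_subset A B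
  have e₁ := (hB W₁).2 (by simp)
  have e₂ := (hB W₂).2 (by simp)
  have e₃ := (hB W₃).2 (by simp)
  have s := t.append h ((Tied.of_mem h e₁ e₂).nCopies h h₁ h₂ n)
  have s' := t'.append h ((Tied.of_mem h e₂ e₃).nCopies h h₂ h₃ n)
  have hW₂ : W₂ ∈ R.choice (A ++ nCopies n B) := by
    obtain ⟨V, hV⟩ := R.nonempty (A ++ nCopies n B)
    rcases (hB V).1 (hn hV) with rfl | rfl | rfl
    · exact s.mem h hV
    · exact hV
    · exact s'.symm.mem h hV
  exact ⟨nCopies n B, h.mem_nCopies e₁ n, h.mem_nCopies e₃ n, s.symm.mem h hW₂, s'.mem h hW₂⟩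

/-- A set of ballots closed under a permutation gives an invariant profile. -/
lemma map_toList_perm {F : Finset (Finset (Fin m))} (σ : Equiv.Perm (Fin m))
    (hF : ∀ t ∈ F, t.image σ ∈ F) : (F.toList.map fun s => s.image σ).Perm F.toList := by
  have hinj : Function.Injective fun s : Finset (Fin m) => s.image σ :=
    Finset.image_injective σ.injective
  refine (List.perm_ext_iff_of_nodup (F.nodup_toList.map hinj) F.nodup_toList).2 fun t => ?_
  have himg : F.image (fun s : Finset (Fin m) => s.image σ) = F :=
    Finset.eq_of_subset_of_card_le
      (Finset.image_subset_iff.2 hF) (Finset.card_image_of_injective _ hinj).ge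
  conv_rhs => rw [← himg]
  simp

lemma tied_singleton_of_disjoint (h : ChoicePostulates R) (hk : 0 < k) (hkm : k < m)
    (hnt : ¬ CTrivial m k R) {s W W' : Finset (Fin m)} (hW : W.card = k) (hW' : W'.card = k)
    (hs : Disjoint W s) (hs' : Disjoint W' s) : Tied R W W' [s] := by
  classical
  rcases s.eq_empty_or_nonempty with rfl | hsne
  · obtain ⟨V, hV⟩ := R.nonempty [∅]
    exact Tied.of_mem h (h.mem_singleton_of_le hV hW (by simp))
      (h.mem_singleton_of_le hV hW' (by simp))
  set E := Finset.powersetCard s.card (Finset.univ : Finset (Fin m)) with hE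
  have hinv : ∀ (σ : Equiv.Perm (Fin m)), ∀ t ∈ E, t.image σ ∈ E := by
    intro σ t ht
    simp only [hE, Finset.mem_powersetCard_univ] at ht ⊢
    rw [Finset.card_image_of_injective _ σ.injective, ht]
  have hp : ([s] ++ (E.erase s).toList).Perm E.toList := by
    refine (List.perm_ext_iff_of_nodup ?_ E.nodup_toList).2 fun t => ?_
    · simpa using (E.erase s).nodup_toList
    · by_cases hts : t = s <;> simp [hts, hE]
  have hall : ∀ V : Finset (Fin m), V.card = k → V ∈ R.choice ([s] ++ (E.erase s).toList) := by
    intro V hV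
    rw [h.anon _ _ hp]
    obtain ⟨U, hU⟩ := R.nonempty E.toList
    obtain ⟨σ, -, rfl⟩ := exists_perm_image (s := ∅) (V := U) (W := V)
      ((R.card_eq _ _ hU).trans hV.symm) (by simp)
    exact h.image_mem hU σ (map_toList_perm σ (hinv σ))
  obtain ⟨V, hV⟩ := R.nonempty (E.erase s).toList
  have hVk := R.card_eq _ _ hV
  have hVs : V ∩ s = ∅ := by
    by_contra hne
    have hVs := h.mem_singleton_of_inter hk hVk (Finset.nonempty_iff_ne_empty.2 hne)
    have hWs := ((h.mem_append_iff hVs hV).1 (hall W hW)).1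
    exact Finset.not_disjoint_iff_nonempty_inter.2
      ((h.mem_singleton_iff hk hkm hnt hsne).1 hWs).2 hs
  have hmem : ∀ U : Finset (Fin m), U.card = k → Disjoint U s →
      U ∈ R.choice (E.erase s).toList := by
    intro U hU hUs
    obtain ⟨σ, hσ, rfl⟩ := exists_perm_image (s := s) (hVk.trans hU.symm)
      (by rw [hVs, Finset.disjoint_iff_inter_eq_empty.1 hUs])
    refine h.image_mem hV σ (map_toList_perm σ fun t ht => ?_)
    rw [Finset.mem_erase] at ht ⊢
    refine ⟨fun e => ht.1 (Finset.image_injective σ.injective ?_), hinv σ t ht.2⟩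
    exact e.trans hσ.symm
  exact ⟨_, hmem W hW hs, hmem W' hW' hs', hall W hW, hall W' hW'⟩

lemma tied_singleton (h : ChoicePostulates R) (hk : 0 < k) (hkm : k < m)
    (hnt : ¬ CTrivial m k R) {s W W' : Finset (Fin m)} (hW : W.card = k) (hW' : W'.card = k)
    (hs : (W ∩ s).Nonempty ↔ (W' ∩ s).Nonempty) : Tied R W W' [s] := by
  by_cases hW1 : (W ∩ s).Nonempty
  · exact Tied.of_mem h (h.mem_singleton_of_inter hk hW hW1)
      (h.mem_singleton_of_inter hk hW' (hs.1 hW1))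
  · have hW2 := hs.not.1 hW1
    rw [← Finset.not_disjoint_iff_nonempty_inter, not_not] at hW1 hW2
    exact h.tied_singleton_of_disjoint hk hkm hnt hW hW' hW1 hW2

lemma exists_mem_superset_of_two_parties (h : ChoicePostulates R) {C a b : Finset (Fin m)} {n : ℕ}
    (hn : n ≠ 0) (hC : C.card + 1 = k) (ha : a.Nonempty) (hb : b.Nonempty)
    (hab : Disjoint a b) (hCa : Disjoint C a) (hCb : Disjoint C b) :
    ∃ V ∈ R.choice ([a, b] ++ nCopies n (singles C)), C ⊆ V ∧ (V ∩ a).Nonempty := by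
  have hta : ∀ t ∈ singles C, Disjoint t a := fun t ht => disjoint_of_mem_singles hCa ht
  have htb : ∀ t ∈ singles C, Disjoint t b := fun t ht => disjoint_of_mem_singles hCb ht
  have ne_of_disjoint : ∀ {t u : Finset (Fin m)}, u.Nonempty → Disjoint t u → u ≠ t :=
    fun hu hd e => hu.ne_empty (disjoint_self.1 (e ▸ hd))
  have hcount : ∀ t ∈ singles C, ([a, b] ++ nCopies n (singles C)).count t = n := by
    intro t ht
    rw [List.count_append, count_nCopies, List.count_eq_one_of_mem (nodup_singles C) ht]
    simp [ne_of_disjoint ha (hta t ht), ne_of_disjoint hb (htb t ht)]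
  have hca : ([a, b] ++ nCopies n (singles C)).count a = 1 := by
    rw [List.count_append, count_nCopies,
      List.count_eq_zero_of_not_mem fun hm => ne_of_disjoint ha (hta a hm) rfl]
    simp [ne_of_disjoint hb hab]
  have hcb : ([a, b] ++ nCopies n (singles C)).count b = 1 := by
    rw [List.count_append, count_nCopies,
      List.count_eq_zero_of_not_mem fun hm => ne_of_disjoint hb (htb b hm) rfl]
    simp [(ne_of_disjoint hb hab).symm]
  have hV : ∃ V ∈ R.choice ([a, b] ++ nCopies n (singles C)),
      ∀ t ∈ (singles C ++ [a, b]).take k, (V ∩ t).Nonempty := by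
    apply h.exists_mem_of_parties
    · intro t ht
      simp only [List.mem_append, List.mem_cons, List.not_mem_nil, or_false] at ht
      rcases ht with ht | rfl | rfl
      · exact nonempty_of_mem_singles ht
      · exact ha
      · exact hb
    · refine List.pairwise_append.2 ⟨pairwise_disjoint_singles C, by simpa, ?_⟩
      intro t ht u hu
      simp only [List.mem_cons, List.not_mem_nil, or_false] at hu
      rcases hu with rfl | rfl
      · exact hta t ht
      · exact htb t ht
    · intro t
      rw [List.mem_append, List.mem_append, ABC.mem_nCopies hn, or_comm]
    · refine List.pairwise_append.2 ⟨?_, ?_, ?_⟩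
      · exact List.pairwise_of_forall_mem_list fun t ht u hu =>
          ((hcount u hu).trans (hcount t ht).symm).le
      · exact List.pairwise_pair.2 (hcb.trans hca.symm).le
      · intro t ht u hu
        rw [hcount t ht]
        simp only [List.mem_cons, List.not_mem_nil, or_false] at hu
        rcases hu with rfl | rfl
        · rw [hca]; omega
        · rw [hcb]; omega
  obtain ⟨V, hV, hVs⟩ := hV
  have htake : (singles C ++ [a, b]).take k = singles C ++ [a] := by
    rw [List.take_append, length_singles, List.take_of_length_le (by rw [length_singles]; omega),
      show k - C.card = 1 by omega]
    rfl
  rw [htake] at hVs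
  exact ⟨V, hV, subset_of_forall_singles fun s hs => hVs s (by simp [hs]), hVs a (by simp)⟩

/-- Two committees differing in one candidate are tied between a ballot covered only by the
first one and a singleton ballot covered only by the second one. -/
lemma tied_pair_insert (h : ChoicePostulates R) (hk : 0 < k) {C s : Finset (Fin m)}
    {x y : Fin m} (hC : C.card + 1 = k) (hxC : x ∉ C) (hyC : y ∉ C)
    (hxs : x ∈ s) (hCs : Disjoint C s) (hys : y ∉ s) :
    Tied R (insert x C) (insert y C) [s, {y}] := by
  obtain ⟨n, hn, hsub⟩ := h.exists_choice_append_nCopies_subset [s, {y}] (singles C)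
  have key : ∀ z ∉ C, insert z C ∈ R.choice (singles C) := by
    intro z hz
    have hz' : (insert z C).card = k := by rw [Finset.card_insert_of_notMem hz, hC]
    refine (h.mem_iff_forall hz' ?_).2 ⟨hz', ?_⟩ <;>
    · intro t ht
      obtain ⟨c, hc, rfl⟩ := mem_singles.1 ht
      exact h.mem_singleton_of_inter hk hz' ⟨c, by simp [hc]⟩
  have eq_insert : ∀ {V : Finset (Fin m)} {z : Fin m}, V.card = k → C ⊆ V → z ∈ V → z ∉ C →
      V = insert z C := by
    intro V z hV hCV hzV hz
    refine (Finset.eq_of_subset_of_card_le (Finset.insert_subset hzV hCV) ?_).symm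
    rw [Finset.card_insert_of_notMem hz]
    omega
  have hsy : Disjoint s {y} := by simpa
  have hCy : Disjoint C {y} := by simpa
  refine ⟨nCopies n (singles C), h.mem_nCopies (key x hxC) n, h.mem_nCopies (key y hyC) n, ?_, ?_⟩
  · obtain ⟨V, hV, hCV, z, hz⟩ := h.exists_mem_superset_of_two_parties hn hC ⟨x, hxs⟩
      (Finset.singleton_nonempty y) hsy hCs hCy
    rw [Finset.mem_inter] at hz
    have hzC : z ∉ C := fun hzC => Finset.disjoint_left.1 hCs hzC hz.2
    obtain rfl := eq_insert (R.card_eq _ _ hV) hCV hz.1 hzC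
    have fix : ∀ t : Finset (Fin m), (x ∈ t ↔ z ∈ t) → t.image (Equiv.swap x z) = t := by
      intro t ht
      ext a
      rw [← Equiv.coe_toEmbedding, ← Finset.map_eq_image, Finset.mem_map_equiv, Equiv.symm_swap]
      rcases eq_or_ne a x with rfl | hax
      · rw [Equiv.swap_apply_left]; exact ht.symm
      · rcases eq_or_ne a z with rfl | haz
        · rw [Equiv.swap_apply_right]; exact ht
        · rw [Equiv.swap_apply_of_ne_of_ne hax haz]
    have hxy : x ≠ y := fun e => hys (e ▸ hxs)
    have hzy : z ≠ y := fun e => hys (e ▸ hz.2)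
    have hfixC := fix C (by simp [hxC, hzC])
    have := h.image_mem hV (Equiv.swap x z) ?_
    · rwa [Finset.image_insert, Equiv.swap_apply_right, hfixC] at this
    · refine List.Perm.of_eq ?_
      conv_rhs => rw [← List.map_id ([s, {y}] ++ nCopies n (singles C))]
      refine List.map_congr_left fun t ht => fix t ?_
      rw [List.mem_append, ABC.mem_nCopies hn, mem_singles] at ht
      simp only [List.mem_cons, List.not_mem_nil, or_false] at ht
      rcases ht with (rfl | rfl) | ⟨c, hc, rfl⟩
      · simp [hxs, hz.2]
      · simp [hxy, hzy]
      · have hxc : x ≠ c := fun e => hxC (e ▸ hc)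
        have hzc : z ≠ c := fun e => hzC (e ▸ hc)
        simp [hxc, hzc]
  · obtain ⟨V, hV, hCV, z, hz⟩ := h.exists_mem_superset_of_two_parties hn hC
      (Finset.singleton_nonempty y) ⟨x, hxs⟩ hsy.symm hCy hCs
    rw [Finset.mem_inter, Finset.mem_singleton] at hz
    obtain ⟨hzV, rfl⟩ := hz
    obtain rfl := eq_insert (R.card_eq _ _ hV) hCV hzV hyC
    rwa [h.anon _ ([{z}, s] ++ nCopies n (singles C)) ((List.Perm.swap _ _ _).append_right _)]

lemma tied_pair (h : ChoicePostulates R) (hk : 0 < k) (hkm : k < m) (hnt : ¬ CTrivial m k R)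
    {s W W' : Finset (Fin m)} {y : Fin m} (hW : W.card = k) (hW' : W'.card = k)
    (hs : (W ∩ s).Nonempty) (hs' : Disjoint W' s) (hy : y ∉ W) (hy' : y ∈ W') :
    Tied R W W' [s, {y}] := by
  obtain ⟨x, hx⟩ := hs
  rw [Finset.mem_inter] at hx
  have hxW' : x ∉ W' := fun hxW' => Finset.disjoint_left.1 hs' hxW' hx.2
  have hys : y ∉ s := Finset.disjoint_left.1 hs' hy'
  have hxmem : x ∈ W \ W' := by simp [hx.1, hxW']
  obtain ⟨d, hd⟩ : ∃ d, (W \ W').card = d + 1 :=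
    ⟨_, (Nat.succ_pred_eq_of_pos (Finset.card_pos.2 ⟨x, hxmem⟩)).symm⟩
  induction d generalizing W with
  | zero =>
    have h1 := Finset.card_sdiff_add_card_inter W W'
    have h2 := Finset.card_sdiff_add_card_inter W' W
    rw [Finset.inter_comm W' W] at h2
    have hins : ∀ {U U' : Finset (Fin m)} {z : Fin m}, z ∈ U → z ∉ U' →
        (U \ U').card = 1 → insert z (U ∩ U') = U := by
      intro U U' z hz hz' hc
      obtain ⟨w, hw⟩ := Finset.card_eq_one.1 hc
      have hzw : z = w := Finset.mem_singleton.1 (hw ▸ Finset.mem_sdiff.2 ⟨hz, hz'⟩)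
      rw [Finset.insert_eq, hzw, ← hw, Finset.sdiff_union_inter]
    have e := hins hx.1 hxW' (by omega)
    have e' := hins hy' hy (by omega)
    rw [Finset.inter_comm] at e'
    have := h.tied_pair_insert hk (C := W ∩ W') (s := s) (x := x) (y := y) (by omega)
      (by simp [hxW']) (by simp [hy]) hx.2 (hs'.mono_left Finset.inter_subset_right) hys
    rwa [e, e'] at this
  | succ d ih =>
    have h1 := Finset.card_sdiff_add_card_inter W W'
    have h2 := Finset.card_sdiff_add_card_inter W' W
    rw [Finset.inter_comm W' W] at h2
    obtain ⟨x₂, hx₂⟩ : ((W \ W').erase x).Nonempty := Finset.card_pos.1 (by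
      rw [Finset.card_erase_of_mem hxmem]; omega)
    obtain ⟨y₂, hy₂⟩ : ((W' \ W).erase y).Nonempty := Finset.card_pos.1 (by
      rw [Finset.card_erase_of_mem (by simp [hy, hy'])]; omega)
    simp only [Finset.mem_erase, Finset.mem_sdiff] at hx₂ hy₂
    have hy₂' : y₂ ∉ W.erase x₂ := fun hm => hy₂.2.2 (Finset.mem_of_mem_erase hm)
    have hUk : (insert y₂ (W.erase x₂)).card = k := by
      rw [Finset.card_insert_of_notMem hy₂', Finset.card_erase_of_mem hx₂.2.1]; omega
    have hxU : x ∈ insert y₂ (W.erase x₂) := by simp [hx.1, hx₂.1.symm]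
    have hyU : y ∉ insert y₂ (W.erase x₂) := by simp [hy, hy₂.1.symm]
    have hUd : insert y₂ (W.erase x₂) \ W' = (W \ W').erase x₂ := by
      rw [Finset.insert_sdiff_of_mem _ hy₂.2.1, Finset.erase_sdiff_comm]
    refine h.tied_trans hk hkm hnt hW hUk hW' ?_ (ih hUk hyU ⟨hxU, hx.2⟩ ?_ ?_)
    · refine Tied.append h (A := [s]) (A' := [{y}]) ?_ ?_
      · exact h.tied_singleton hk hkm hnt hW hUk
          ⟨fun _ => ⟨x, by simp only [Finset.mem_inter]; exact ⟨hxU, hx.2⟩⟩,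
            fun _ => ⟨x, by simp [hx]⟩⟩
      · exact h.tied_singleton_of_disjoint hk hkm hnt hW hUk (by simpa using hy)
          (Finset.disjoint_singleton_right.2 hyU)
    · exact Finset.mem_sdiff.2 ⟨hxU, hxW'⟩
    · rw [hUd, Finset.card_erase_of_mem (by simp [hx₂.2])]; omega

end ChoicePostulates

/-- The number of ballots in `A` approving some member of `W`. -/
def cover (W : Finset (Fin m)) (A : Profile m) : ℕ :=
  A.countP fun s => decide (W ∩ s).Nonempty

lemma score_fCC (W : Finset (Fin m)) (A : Profile m) : score fCC W A = cover W A := by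
  induction A with
  | nil => simp [score, cover]
  | cons s A ih =>
    simp only [score, cover, List.map_cons, List.sum_cons, List.countP_cons] at ih ⊢
    rw [ih, Finset.inter_comm s W, add_comm, Nat.cast_add]
    congr 1
    by_cases hs : W ∩ s = ∅ <;> simp [fCC, hs, Finset.nonempty_iff_ne_empty]

lemma cover_append (W : Finset (Fin m)) (A B : Profile m) :
    cover W (A ++ B) = cover W A + cover W B := List.countP_append

lemma cover_nCopies (W : Finset (Fin m)) (n : ℕ) (A : Profile m) :
    cover W (nCopies n A) = n * cover W A := by
  induction n with
  | zero => simp [nCopies, cover]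
  | succ n ih => rw [nCopies_succ, cover_append, ih]; ring

namespace ChoicePostulates

/-- Adding suitably many singleton ballots makes `W` and `W'` tied. -/
lemma exists_tied_append (h : ChoicePostulates R) (hk : 0 < k) (hkm : k < m)
    (hnt : ¬ CTrivial m k R) {W W' : Finset (Fin m)} {x y : Fin m} (hW : W.card = k)
    (hW' : W'.card = k) (hx : x ∈ W) (hx' : x ∉ W') (hy : y ∉ W) (hy' : y ∈ W')
    (A : Profile m) :
    ∃ p q, Tied R W W' (A ++ (List.replicate p {y} ++ List.replicate q {x})) ∧
      cover W A + q = cover W' A + p := by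
  induction A with
  | nil => exact ⟨0, 0, by simpa using Tied.of_mem h (h.mem_nil hW) (h.mem_nil hW'), rfl⟩
  | cons s A ih =>
    obtain ⟨p, q, t, hpq⟩ := ih
    simp only [cover, List.countP_cons, decide_eq_true_eq] at hpq ⊢
    by_cases h1 : (W ∩ s).Nonempty <;> by_cases h2 : (W' ∩ s).Nonempty
    · exact ⟨p, q, Tied.append h (A := [s]) (h.tied_singleton hk hkm hnt hW hW' (by tauto)) t,
        by simp only [if_pos h1, if_pos h2]; omega⟩
    · refine ⟨p + 1, q, ((h.tied_pair hk hkm hnt hW hW' h1 ?_ hy hy').append h t).perm h ?_,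
        by simp only [if_pos h1, if_neg h2]; omega⟩
      · rwa [← not_not (a := Disjoint _ _), Finset.not_disjoint_iff_nonempty_inter]
      · refine List.perm_iff_count.2 fun u => ?_
        simp only [List.replicate_succ, List.count_append, List.count_cons, List.count_nil]
        omega
    · refine ⟨p, q + 1, ((h.tied_pair hk hkm hnt hW' hW h2 ?_ hx' hx).symm.append h t).perm h ?_,
        by simp only [if_neg h1, if_pos h2]; omega⟩
      · rwa [← not_not (a := Disjoint _ _), Finset.not_disjoint_iff_nonempty_inter]
      · refine List.perm_iff_count.2 fun u => ?_
        simp only [List.replicate_succ, List.count_append, List.count_cons, List.count_nil]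
        omega
    · exact ⟨p, q, Tied.append h (A := [s]) (h.tied_singleton hk hkm hnt hW hW' (by tauto)) t,
        by simp only [if_neg h1, if_neg h2]; omega⟩

lemma mem_and_cover_eq_of_cover_le (h : ChoicePostulates R) (hk : 0 < k) (hkm : k < m)
    (hnt : ¬ CTrivial m k R) {W W' : Finset (Fin m)} {A : Profile m} (hW' : W'.card = k)
    (hWA : W ∈ R.choice A) (hle : cover W A ≤ cover W' A) :
    W' ∈ R.choice A ∧ cover W A = cover W' A := by
  rcases eq_or_ne W W' with rfl | hne
  · exact ⟨hWA, rfl⟩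
  have hW := R.card_eq _ _ hWA
  obtain ⟨x, hx, hx'⟩ := exists_mem_notMem_of_ne (hW'.trans hW.symm) hne.symm
  obtain ⟨y, hy', hy⟩ := exists_mem_notMem_of_ne (hW.trans hW'.symm) hne
  obtain ⟨p, q, t, hpq⟩ := h.exists_tied_append hk hkm hnt hW hW' hx hx' hy hy' A
  obtain ⟨j, rfl⟩ : ∃ j, q = p + j := Nat.exists_eq_add_of_le (by omega)
  have tp : Tied R W W' (nCopies p [{x}, {y}]) :=
    (h.tied_pair hk hkm hnt hW hW' ⟨x, by simp [hx]⟩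
      (Finset.disjoint_singleton_right.2 hx') hy hy').nCopies h hW hW' p
  have tA : Tied R W W' (A ++ List.replicate j {x}) := by
    refine Tied.of_append h (t.perm h ?_) tp
    refine List.perm_iff_count.2 fun u => ?_
    simp only [List.count_append, count_nCopies, List.count_replicate, List.count_cons,
      List.count_nil]
    split_ifs <;> simp <;> omega
  have hWx : ∀ s ∈ List.replicate j ({x} : Finset (Fin m)), W ∈ R.choice [s] := by
    intro s hs
    rw [List.eq_of_mem_replicate hs]
    exact h.mem_singleton_of_inter hk hW ⟨x, by simp [hx]⟩
  have hWj : W ∈ R.choice (List.replicate j {x}) := (h.mem_iff_forall hW hWx).2 ⟨hW, hWx⟩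
  obtain ⟨h1, h2⟩ := (h.mem_append_iff hWA hWj).1 (tA.mem h (h.mem_append hWA hWj))
  refine ⟨h1, ?_⟩
  rcases j with _ | j
  · omega
  · have := ((h.mem_iff_forall hW hWx).1 h2).2 {x} (by simp)
    exact absurd this (h.notMem_singleton_singleton hk hkm hnt hx')

end ChoicePostulates

lemma choice_eq_of_postulates (h : ChoicePostulates R) (hk : 0 < k) (hkm : k < m)
    (hnt : ¬ CTrivial m k R) (A : Profile m) (W : Finset (Fin m)) :
    W ∈ R.choice A ↔ W.card = k ∧ ∀ W' : Finset (Fin m), W'.card = k → cover W' A ≤ cover W A := by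
  constructor
  · refine fun hW => ⟨R.card_eq _ _ hW, fun W' hW' => ?_⟩
    rcases le_total (cover W' A) (cover W A) with hle | hle
    · exact hle
    · exact (h.mem_and_cover_eq_of_cover_le hk hkm hnt hW' hW hle).2.ge
  · rintro ⟨hW, hmax⟩
    obtain ⟨V, hV⟩ := R.nonempty A
    exact (h.mem_and_cover_eq_of_cover_le hk hkm hnt hW hV (hmax V (R.card_eq _ _ hV))).1

lemma cover_image (W : Finset (Fin m)) (A : Profile m) (σ : Equiv.Perm (Fin m)) :
    cover (W.image σ) (A.map fun s => s.image σ) = cover W A := by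
  rw [cover, List.countP_map]
  refine List.countP_congr fun s _ => ?_
  simp [← Finset.image_inter _ _ σ.injective]

lemma cover_eq_sum {A : Profile m} {p : ℕ} {Cs : Fin p → Finset (Fin m)}
    (hinj : Function.Injective Cs) (hA : ∀ s ∈ A, ∃ i, s = Cs i) (W : Finset (Fin m)) :
    cover W A = ∑ i with (W ∩ Cs i).Nonempty, A.count (Cs i) := by
  induction A with
  | nil => simp [cover]
  | cons s A ih =>
    obtain ⟨j, rfl⟩ := hA s (by simp)
    specialize ih fun t ht => hA t (List.mem_cons_of_mem _ ht)
    simp only [cover, List.countP_cons, List.count_cons, Finset.sum_add_distrib] at ih ⊢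
    rw [ih, Finset.sum_filter, Finset.sum_filter]
    simp [hinj.eq_iff]
    rw [Finset.sum_eq_single j (fun i _ hij => by simp [hij.symm]) (by simp)]
    simp

/-- A set of at most `k` indices has no larger sum than the first `k` indices of an antitone
sequence. -/
lemma sum_le_sum_initial {p : ℕ} {g : Fin p → ℕ} (hg : Antitone g) {H : Finset (Fin p)}
    (hH : H.card ≤ k) : ∑ i ∈ H, g i ≤ ∑ i with i.val < k, g i := by
  rcases le_or_gt p k with hpk | hpk
  · refine Finset.sum_le_sum_of_subset fun i _ => ?_
    simpa using i.2.trans_le hpk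
  set F : Finset (Fin p) := Finset.univ.filter fun i => i.val < k with hF
  have hFc : F.card = k := by
    have : F = Finset.Iio ⟨k, hpk⟩ := by ext i; simp [hF, Fin.lt_def]
    rw [this, Fin.card_Iio]
  have h1 := Finset.card_sdiff_add_card_inter H F
  have h2 := Finset.card_sdiff_add_card_inter F H
  rw [Finset.inter_comm] at h2
  rw [← Finset.sum_inter_add_sum_sdiff H F, ← Finset.sum_inter_add_sum_sdiff F H,
    Finset.inter_comm F H]
  refine Nat.add_le_add_left ?_ _
  calc ∑ i ∈ H \ F, g i ≤ (H \ F).card • g ⟨k, hpk⟩ :=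
        Finset.sum_le_card_nsmul _ _ _ fun i hi => hg (by
          simp only [hF, Finset.mem_sdiff, Finset.mem_filter, Finset.mem_univ, true_and] at hi
          exact Fin.le_def.2 (not_lt.1 hi.2))
    _ ≤ (F \ H).card • g ⟨k, hpk⟩ := nsmul_le_nsmul_left (Nat.zero_le _) (by omega)
    _ ≤ ∑ i ∈ F \ H, g i := Finset.card_nsmul_le_sum _ _ _ fun i hi => hg (by
          simp only [hF, Finset.mem_sdiff, Finset.mem_filter, Finset.mem_univ, true_and] at hi
          exact Fin.le_def.2 hi.1.le)

lemma card_filter_inter_nonempty_le {p : ℕ} {Cs : Fin p → Finset (Fin m)}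
    (hd : ∀ i j, i ≠ j → Disjoint (Cs i) (Cs j)) (W : Finset (Fin m)) :
    (Finset.univ.filter fun i => (W ∩ Cs i).Nonempty).card ≤ W.card := by
  rw [Finset.card_eq_sum_ones]
  calc ∑ i with (W ∩ Cs i).Nonempty, 1
      ≤ ∑ i with (W ∩ Cs i).Nonempty, (W ∩ Cs i).card :=
        Finset.sum_le_sum fun i hi => (Finset.mem_filter.1 hi).2.card_pos
    _ = ((Finset.univ.filter fun i => (W ∩ Cs i).Nonempty).biUnion fun i => W ∩ Cs i).card :=
        (Finset.card_biUnion fun i _ j _ hij => (hd i j hij).mono Finset.inter_subset_right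
          Finset.inter_subset_right).symm
    _ ≤ W.card := Finset.card_le_card (Finset.biUnion_subset.2 fun i _ =>
        Finset.inter_subset_left)

lemma postulates_of_choice_eq (hkm : k ≤ m) (hR : ∀ A W, W ∈ R.choice A ↔
    W.card = k ∧ ∀ W' : Finset (Fin m), W'.card = k → cover W' A ≤ cover W A) :
    ChoicePostulates R where
  anon A A' hp := by
    ext W
    have hc : ∀ V : Finset (Fin m), cover V A = cover V A' := fun V => hp.countP_eq _
    simp only [hR, hc]
  neut σ A := by
    have hcard : ∀ (τ : Equiv.Perm (Fin m)) (V : Finset (Fin m)), (V.image τ).card = V.card :=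
      fun τ V => Finset.card_image_of_injective _ τ.injective
    have himg : ∀ V : Finset (Fin m), (V.image σ.symm).image σ = V := by
      intro V
      simp [Finset.image_image]
    ext W
    simp only [hR, Set.mem_image]
    constructor
    · rintro ⟨hW, hmax⟩
      refine ⟨W.image σ.symm, ⟨(hcard _ _).trans hW, fun V hV => ?_⟩, himg W⟩
      have := hmax (V.image σ) ((hcard _ _).trans hV)
      rwa [cover_image, ← himg W, cover_image] at this
    · rintro ⟨U, ⟨hU, hmax⟩, rfl⟩
      refine ⟨(hcard _ _).trans hU, fun V hV => ?_⟩
      rw [← himg V, cover_image, cover_image]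
      exact hmax _ ((hcard _ _).trans hV)
  cons A A' := by
    rintro ⟨U, hU, hU'⟩
    rw [hR] at hU hU'
    ext W
    simp only [Set.mem_inter_iff, hR, cover_append]
    constructor
    · rintro ⟨hW, hmax⟩
      have h1 := hmax U hU.1
      have h2 := hU.2 W hW
      have h3 := hU'.2 W hW
      refine ⟨⟨hW, fun V hV => ?_⟩, ⟨hW, fun V hV => ?_⟩⟩
      · have := hU.2 V hV
        omega
      · have := hU'.2 V hV
        omega
    · rintro ⟨⟨hW, h1⟩, ⟨-, h2⟩⟩
      exact ⟨hW, fun V hV => Nat.add_le_add (h1 V hV) (h2 V hV)⟩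
  weff A W hW c hc hcA c' hc' := by
    rw [hR] at hW ⊢
    have hnot : c' ∉ W.erase c := fun hm => hc' (Finset.mem_of_mem_erase hm)
    refine ⟨?_, fun V hV => (hW.2 V hV).trans ?_⟩
    · rw [Finset.card_insert_of_notMem hnot, Finset.card_erase_add_one hc, hW.1]
    · refine List.countP_mono_left fun s hs => ?_
      simp only [decide_eq_true_eq]
      rintro ⟨a, ha⟩
      rw [Finset.mem_inter] at ha
      have hac : a ≠ c := fun e => hcA s hs (e ▸ ha.2)
      exact ⟨a, by simp [ha, hac]⟩
  cont A A' _ := by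
    refine ⟨A.length + 1, fun V hV => ?_⟩
    rw [hR] at hV ⊢
    refine ⟨hV.1, fun W hW => ?_⟩
    have h1 := hV.2 W hW
    have h2 : cover V A ≤ A.length := List.countP_le_length
    simp only [cover_append, cover_nCopies] at h1
    by_contra! hlt
    nlinarith [Nat.mul_le_mul_left (A.length + 1) hlt]
  div A p Cs hP hs := by
    obtain ⟨hne, hd, hA, -⟩ := hP
    choose c hc using hne
    obtain ⟨W, hsub, -, hW⟩ := Finset.exists_subsuperset_card_eq (n := k)
      (Finset.subset_univ ((Finset.univ.filter fun i : Fin p => i.val < k).image c))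
      (Finset.card_image_le.trans (by
        simpa using Finset.card_le_card_of_injOn (t := Finset.range k) (fun i : Fin p => i.val)
          (by intro i hi; simpa using hi) Fin.val_injective.injOn))
      (by simpa using hkm)
    have hWi : ∀ i : Fin p, i.val < k → (W ∩ Cs i).Nonempty := fun i hi =>
      ⟨c i, Finset.mem_inter.2 ⟨hsub (Finset.mem_image_of_mem c (by simpa using hi)), hc i⟩⟩
    have hinj : Function.Injective Cs := by
      intro i j hij
      by_contra hne
      exact Finset.disjoint_left.1 (hd i j hne) (hc i) (hij ▸ hc i)
    refine ⟨W, (hR A W).2 ⟨hW, fun V hV => ?_⟩, hWi⟩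
    rw [cover_eq_sum hinj hA, cover_eq_sum hinj hA]
    refine (sum_le_sum_initial hs (hV ▸ card_filter_inter_nonempty_le hd V)).trans ?_
    refine Finset.sum_le_sum_of_subset fun i hi => ?_
    simpa using hWi i (by simpa using hi)

end Choice

/-- the Approval Chamberlin–Courant rule is the only non-trivial
ABC choice rule satisfying symmetry, consistency, weak efficiency, continuity,
and disjoint diversity. -/
theorem statement19 (m k : ℕ) (hk : 0 < k) (hkm : k < m) (R : ABCChoiceRule m k)
    (hnt : ¬ CTrivial m k R) :
    ((CAnonymous m k R ∧ CNeutral m k R) ∧ CConsistent m k R ∧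
      CWeakEfficient m k R ∧ CContinuous m k R ∧ CDisjointDiversity m k R) ↔
    (∀ A : Profile m, R.choice A =
      {W : Finset (Fin m) | W.card = k ∧
        ∀ W' : Finset (Fin m), W'.card = k → score fCC W' A ≤ score fCC W A}) := by
  simp only [score_fCC, Nat.cast_le]
  constructor
  · rintro ⟨⟨hanon, hneut⟩, hcons, hweff, hcont, hdiv⟩ A
    ext W
    exact choice_eq_of_postulates ⟨hanon, hneut, hcons, hweff, hcont, hdiv⟩ hk hkm hnt A W
  · intro hR
    have h : ChoicePostulates R := postulates_of_choice_eq hkm.le fun A W => by rw [hR A]; rfl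
    exact ⟨⟨h.anon, h.neut⟩, h.cons, h.weff, h.cont, h.div⟩

end ABC
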